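/- (Theorem 3.) Fix integers n ≥ 1 and k ≥ 0, and let g₁ = R(π/n, π/n). A function f : ℝ⁴ → ℝ that is the evaluation of a homogeneous harmonic polynomial of degree k satisfies f ∘ g₁ = f and f ∘ A = f if and only if f is a real linear combination of the following functions, where ℓ and m range over positive integers and every function F_{k,ℓ,m} appearing is subject to |ℓ| + |m| ≤ k and ℓ + m ≡ k (mod 2), with d = (k − |ℓ| − |m|)/2: F_{k,0,0} when k ≡ 0 (mod 4); F_{k,ℓ,0} + F_{k,0,ℓ} and F_{k,−ℓ,0} − F_{k,0,−ℓ} when ℓ ≡ 0 (mod 2n) and d is even; F_{k,ℓ,0} − F_{k,0,ℓ} and F_{k,−ℓ,0} + F_{k,0,−ℓ} when ℓ ≡ 0 (mod 2n) and d is odd; F_{k,ℓ,ℓ} + F_{k,−ℓ,−ℓ} and F_{k,−ℓ,ℓ} − F_{k,ℓ,−ℓ} when k ≡ 0 (mod 4); F_{k,ℓ,ℓ} − F_{k,−ℓ,−ℓ} when 2ℓ ≡ 0 (mod 2n) and k ≡ 0 (mod 4); F_{k,−ℓ,ℓ} + F_{k,ℓ,−ℓ} when 2ℓ ≡ 0 (mod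 2n) and k ≡ 2 (mod 4); and for distinct positive ℓ ≠ m: (F_{k,ℓ,m} + F_{k,−ℓ,−m}) + (F_{k,m,ℓ} + F_{k,−m,−ℓ}) and (F_{k,ℓ,−m} − F_{k,−ℓ,m}) − (F_{k,−m,ℓ} − F_{k,m,−ℓ}) when ℓ ≡ m (mod 2n) and σ_{kℓm} = +1; (F_{k,ℓ,m} + F_{k,−ℓ,−m}) − (F_{k,m,ℓ} + F_{k,−m,−ℓ}) and (F_{k,ℓ,−m} − F_{k,−ℓ,m}) + (F_{k,−m,ℓ} − F_{k,m,−ℓ}) when ℓ ≡ m (mod 2n) and σ_{kℓm} = −1; (F_{k,ℓ,m} − F_{k,−ℓ,−m}) + (F_{k,m,ℓ} − F_{k,−m,−ℓ}) and (F_{k,ℓ,−m} + F_{k,−ℓ,m}) − (F_{k,−m,ℓ} + F_{k,m,−ℓ}) when ℓ ≡ −m (mod 2n) and σ_{kℓm} = +1; (F_{k,ℓ,m} − F_{k,−ℓ,−m}) − (F_{k,m,ℓ} − F_{k,−m,−ℓ}) and (F_{k,ℓ,−m} + F_{k,−ℓ,m}) + (F_{k,−m,ℓ} + F_{k,m,−ℓ})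 when ℓ ≡ −m (mod 2n) and σ_{kℓm} = −1. -/

import Mathlib

noncomputable section


/-- `circ j u v` is `A_j(u,v)`: the real part of `(u + iv)^|j|` if `j ≥ 0`,
and the imaginary part if `j < 0`. -/
def circ (j : ℤ) (u v : ℝ) : ℝ :=
  if 0 ≤ j then (((u : ℂ) + v * Complex.I) ^ j.natAbs).re
  else (((u : ℂ) + v * Complex.I) ^ j.natAbs).im

/-- `dd k ℓ m = (k - |ℓ| - |m|) / 2`. -/
def dd (k : ℕ) (ℓ m : ℤ) : ℕ := (k - ℓ.natAbs - m.natAbs) / 2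

/-- The function `F_{kℓm} : ℝ⁴ → ℝ`. -/
def F (k : ℕ) (ℓ m : ℤ) (p : Fin 4 → ℝ) : ℝ :=
  (∑ i ∈ Finset.range (dd k ℓ m + 1),
      (Nat.choose (m.natAbs + dd k ℓ m) i : ℝ) *
      (Nat.choose (ℓ.natAbs + dd k ℓ m) (dd k ℓ m - i) : ℝ) *
      (p 0 ^ 2 + p 1 ^ 2) ^ i * (-(p 2 ^ 2 + p 3 ^ 2)) ^ (dd k ℓ m - i))
    * circ ℓ (p 0) (p 1) * circ m (p 2) (p 3)

/-- `f` is the evaluation of a homogeneous polynomial of degree `k`. -/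
def IsHomogeneousPolyEval (k : ℕ) (f : (Fin 4 → ℝ) → ℝ) : Prop :=
  ∃ P : MvPolynomial (Fin 4) ℝ, P.IsHomogeneous k ∧ ∀ v, MvPolynomial.eval v P = f v

/-- `f` is harmonic: the sum of its four second coordinate partial derivatives vanishes. -/
def IsHarmonic (f : (Fin 4 → ℝ) → ℝ) : Prop :=
  ∀ v : Fin 4 → ℝ,
    ∑ i : Fin 4, fderiv ℝ (fun w => fderiv ℝ f w (Pi.single i 1)) v (Pi.single i 1) = 0

/-- The Jacobi polynomial `P_d^{(a,b)}`. -/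
def jacobiP (d a b : ℕ) (u : ℝ) : ℝ :=
  (1 / 2 ^ d) * ∑ i ∈ Finset.range (d + 1),
    (Nat.choose (a + d) i : ℝ) * (Nat.choose (b + d) (d - i) : ℝ) *
      (u + 1) ^ i * (u - 1) ^ (d - i)

/-- The radial function `X_{kℓm}`. -/
def Xrad (k : ℕ) (ℓ m : ℤ) (χ : ℝ) : ℝ :=
  Real.cos χ ^ ℓ.natAbs * Real.sin χ ^ m.natAbs *
    jacobiP (dd k ℓ m) m.natAbs ℓ.natAbs (Real.cos (2 * χ))

/-- The circular harmonic: `cos(|j|·θ)` if `j ≥ 0`, else `sin(|j|·θ)`. -/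
def circHarm (j : ℤ) (θ : ℝ) : ℝ :=
  if 0 ≤ j then Real.cos (j.natAbs * θ) else Real.sin (j.natAbs * θ)

/-- The eigenmode `Ψ̃_{kℓm}` in toroidal coordinates. -/
def PsiT (k : ℕ) (ℓ m : ℤ) (χ θ φ : ℝ) : ℝ :=
  Xrad k ℓ m χ * circHarm ℓ θ * circHarm m φ

/-- The rotation `R(Δθ, Δφ)` of `ℝ⁴`. -/
def Rrot (a b : ℝ) (p : Fin 4 → ℝ) : Fin 4 → ℝ :=
  ![p 0 * Real.cos a - p 1 * Real.sin a,
    p 0 * Real.sin a + p 1 * Real.cos a,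
    p 2 * Real.cos b - p 3 * Real.sin b,
    p 2 * Real.sin b + p 3 * Real.cos b]

/-- The isometry `A(x,y,z,w) = (z, -w, -x, y)`. -/
def Amap (p : Fin 4 → ℝ) : Fin 4 → ℝ :=
  ![p 2, -(p 3), -(p 0), p 1]

/-- The sign `σ_{kℓm}`. -/
def sgn (k : ℕ) (ℓ m : ℤ) : ℝ :=
  (if Even (dd k ℓ m) then 1 else -1) * (if 0 ≤ ℓ then 1 else -1) *
  (if 0 ≤ m then 1 else -1) * (if Even m then 1 else -1)

open MvPolynomial in
theorem hasFDerivAt_eval {σ : Type*} [Fintype σ] (P : MvPolynomial σ ℝ) (v : σ → ℝ) :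
    HasFDerivAt (fun w => eval w P)
      (∑ i, eval v (pderiv i P) • (ContinuousLinearMap.proj i : (σ → ℝ) →L[ℝ] ℝ)) v := by
  classical
  induction P using MvPolynomial.induction_on with
  | C a => simpa using hasFDerivAt_const a v
  | add p q hp hq =>
    simp only [eval_add]
    refine (hp.fun_add hq).congr_fderiv ?_
    simp [add_smul, Finset.sum_add_distrib]
  | mul_X p j hp =>
    have h := hp.mul (ContinuousLinearMap.proj (R := ℝ) (φ := fun _ : σ => ℝ) j).hasFDerivAt
    simp only [eval_mul, eval_X]
    refine h.congr_fderiv ?_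
    ext w
    simp [pderiv_X, Pi.single_apply, apply_ite, mul_add, Finset.sum_add_distrib,
      Finset.mul_sum, mul_comm, mul_left_comm]

open MvPolynomial in
theorem fderiv_eval_single {σ : Type*} [Fintype σ] [DecidableEq σ] (P : MvPolynomial σ ℝ)
    (v : σ → ℝ) (i : σ) :
    fderiv ℝ (fun w => eval w P) v (Pi.single i 1) = eval v (pderiv i P) := by
  rw [(hasFDerivAt_eval P v).fderiv]
  simp [Pi.single_apply]

open MvPolynomial in
theorem sum_pderiv_pderiv_eq_zero {f : (Fin 4 → ℝ) → ℝ} (hh : IsHarmonic f)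
    {P : MvPolynomial (Fin 4) ℝ} (hP : ∀ v, eval v P = f v) :
    ∑ i, pderiv i (pderiv i P) = 0 := by
  obtain rfl : (fun v => eval v P) = f := funext hP
  refine MvPolynomial.funext fun v => ?_
  simpa [fderiv_eval_single] using hh v

open MvPolynomial in
theorem pderiv_aeval_eq_sum {R σ τ : Type*} [CommRing R] [Fintype σ]
    (g : σ → MvPolynomial τ R) (P : MvPolynomial σ R) (j : τ) :
    pderiv j (aeval g P) = ∑ i, aeval g (pderiv i P) * pderiv j (g i) := by
  classical
  induction P using MvPolynomial.induction_on with
  | C a => simp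
  | add p q hp hq => simp only [map_add, hp, hq, add_mul, Finset.sum_add_distrib]
  | mul_X p l hp =>
    have h : ∑ i, aeval g (p * pderiv i (X l)) * pderiv j (g i) = aeval g p * pderiv j (g l) := by
      rw [Finset.sum_eq_single l (fun i _ hi => by rw [pderiv_X_of_ne hi.symm]; simp) (by simp),
        pderiv_X_self, mul_one]
    simp only [pderiv_mul, map_add, add_mul, Finset.sum_add_distrib, h]
    rw [map_mul, aeval_X, pderiv_mul, hp, Finset.sum_mul]
    congr 1
    refine Finset.sum_congr rfl fun i _ => ?_
    rw [map_mul, aeval_X, mul_right_comm]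

open MvPolynomial in
theorem pderiv_pderiv_comm {R σ : Type*} [CommRing R] (P : MvPolynomial σ R) (i j : σ) :
    pderiv i (pderiv j P) = pderiv j (pderiv i P) := by
  classical
  ext m
  simp only [coeff_pderiv, Finsupp.add_apply, Finsupp.single_apply, add_right_comm m]
  by_cases h : i = j
  · subst h; rfl
  · simp [h, Ne.symm h]; ring

/-- The point of `ℂ⁴` with coordinates `x + iy`, its conjugate, `z + iw`, its conjugate. -/
def complexPoint (p : Fin 4 → ℝ) : Fin 4 → ℂ :=
  ![(p 0 : ℂ) + p 1 * Complex.I, (p 0 : ℂ) - p 1 * Complex.I,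
    (p 2 : ℂ) + p 3 * Complex.I, (p 2 : ℂ) - p 3 * Complex.I]

open MvPolynomial in
/-- The linear substitution inverse to `complexPoint`. -/
def complexSubst : Fin 4 → MvPolynomial (Fin 4) ℂ :=
  ![C (1 / 2) * X 0 + C (1 / 2) * X 1, C (-Complex.I / 2) * X 0 + C (Complex.I / 2) * X 1,
    C (1 / 2) * X 2 + C (1 / 2) * X 3, C (-Complex.I / 2) * X 2 + C (Complex.I / 2) * X 3]

open MvPolynomial in
theorem eval_complexPoint_complexSubst (p : Fin 4 → ℝ) (i : Fin 4) :
    eval (complexPoint p) (complexSubst i) = p i := by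
  fin_cases i <;> simp [complexPoint, complexSubst] <;> ring_nf <;> simp

open MvPolynomial in
theorem isHomogeneous_complexSubst (i : Fin 4) : (complexSubst i).IsHomogeneous 1 := by
  fin_cases i <;> exact (isHomogeneous_C_mul_X _ _).add (isHomogeneous_C_mul_X _ _)

open MvPolynomial in
theorem wirtinger_laplacian (P : MvPolynomial (Fin 4) ℂ)
    (hP : ∑ i, pderiv i (pderiv i P) = 0) :
    pderiv 0 (pderiv 1 (aeval complexSubst P)) + pderiv 2 (pderiv 3 (aeval complexSubst P)) = 0 := by
  have h0 (P : MvPolynomial (Fin 4) ℂ) : pderiv 0 (aeval complexSubst P) =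
      aeval complexSubst (C (1 / 2) * pderiv 0 P + C (-Complex.I / 2) * pderiv 1 P) := by
    rw [pderiv_aeval_eq_sum]
    simp [Fin.sum_univ_four, complexSubst, pderiv_X, MvPolynomial.algebraMap_eq]
    ring
  have h1 (P : MvPolynomial (Fin 4) ℂ) : pderiv 1 (aeval complexSubst P) =
      aeval complexSubst (C (1 / 2) * pderiv 0 P + C (Complex.I / 2) * pderiv 1 P) := by
    rw [pderiv_aeval_eq_sum]
    simp [Fin.sum_univ_four, complexSubst, pderiv_X, MvPolynomial.algebraMap_eq]
    ring
  have h2 (P : MvPolynomial (Fin 4) ℂ) : pderiv 2 (aeval complexSubst P) =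
      aeval complexSubst (C (1 / 2) * pderiv 2 P + C (-Complex.I / 2) * pderiv 3 P) := by
    rw [pderiv_aeval_eq_sum]
    simp [Fin.sum_univ_four, complexSubst, pderiv_X, MvPolynomial.algebraMap_eq]
    ring
  have h3 (P : MvPolynomial (Fin 4) ℂ) : pderiv 3 (aeval complexSubst P) =
      aeval complexSubst (C (1 / 2) * pderiv 2 P + C (Complex.I / 2) * pderiv 3 P) := by
    rw [pderiv_aeval_eq_sum]
    simp [Fin.sum_univ_four, complexSubst, pderiv_X, MvPolynomial.algebraMap_eq]
    ring
  rw [h1, h0, h3, h2, ← map_add]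
  have key : C (1 / 2) * pderiv 0 (C (1 / 2) * pderiv 0 P + C (Complex.I / 2) * pderiv 1 P) +
      C (-Complex.I / 2) * pderiv 1 (C (1 / 2) * pderiv 0 P + C (Complex.I / 2) * pderiv 1 P) +
      (C (1 / 2) * pderiv 2 (C (1 / 2) * pderiv 2 P + C (Complex.I / 2) * pderiv 3 P) +
      C (-Complex.I / 2) * pderiv 3 (C (1 / 2) * pderiv 2 P + C (Complex.I / 2) * pderiv 3 P)) =
      C (1 / 4) * ∑ i, pderiv i (pderiv i P) := by
    simp only [map_add, pderiv_C_mul, Fin.sum_univ_four, pderiv_pderiv_comm P 1 0,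
      pderiv_pderiv_comm P 3 2]
    have e1 : (C (-Complex.I / 2) : MvPolynomial (Fin 4) ℂ) * C (Complex.I / 2) = C (1 / 4) := by
      rw [← C_mul]; congr 1; ring_nf; simp; norm_num
    have e2 : (C (1 / 2) : MvPolynomial (Fin 4) ℂ) * C (1 / 2) = C (1 / 4) := by
      rw [← C_mul]; norm_num
    have e3 : (C (-Complex.I / 2) : MvPolynomial (Fin 4) ℂ) = - C (Complex.I / 2) := by
      rw [← C_neg]; ring_nf
    rw [e3] at e1 ⊢
    linear_combination (pderiv 1 (pderiv 1 P) + pderiv 3 (pderiv 3 P)) * e1 +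
      (pderiv 0 (pderiv 0 P) + pderiv 2 (pderiv 2 P)) * e2
  rw [key, hP, mul_zero, map_zero]

open MvPolynomial in
theorem exists_complex_coeff {k : ℕ} {f : (Fin 4 → ℝ) → ℝ} (hf : IsHomogeneousPolyEval k f)
    (hh : IsHarmonic f) :
    ∃ c : (Fin 4 → ℕ) → ℂ, (∀ s, ∑ i, s i ≠ k → c s = 0) ∧
      (∀ a b e g : ℕ, (a + 1) * (b + 1) * c ![a + 1, b + 1, e, g] +
        (e + 1) * (g + 1) * c ![a, b, e + 1, g + 1] = 0) ∧
      ∀ p, (f p : ℂ) = ∑ s ∈ Fintype.piFinset fun _ : Fin 4 => Finset.range (k + 1),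
        c s * ∏ i, complexPoint p i ^ s i := by
  obtain ⟨P, hPk, hP⟩ := hf
  set Q := aeval complexSubst (map (algebraMap ℝ ℂ) P) with hQ
  have hQk : Q.IsHomogeneous k := by
    rw [hQ, ← one_mul k]
    exact (hPk.map (algebraMap ℝ ℂ)).aeval complexSubst isHomogeneous_complexSubst
  have hΔ : pderiv 0 (pderiv 1 Q) + pderiv 2 (pderiv 3 Q) = 0 := by
    apply wirtinger_laplacian
    have := congrArg (map (algebraMap ℝ ℂ)) (sum_pderiv_pderiv_eq_zero hh hP)
    simpa [pderiv_map] using this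
  refine ⟨fun s => coeff (Finsupp.equivFunOnFinite.symm s) Q, fun s hs => ?_, fun a b e g => ?_,
    fun p => ?_⟩
  · refine hQk.coeff_eq_zero fun h => hs ?_
    rw [← h, Finsupp.degree_eq_sum]; rfl
  · have := congrArg (coeff (Finsupp.equivFunOnFinite.symm ![a, b, e, g])) hΔ
    simp only [coeff_add, coeff_pderiv, coeff_zero] at this
    have e1 : Finsupp.equivFunOnFinite.symm ![a, b, e, g] + Finsupp.single 0 1 +
        Finsupp.single 1 1 = Finsupp.equivFunOnFinite.symm ![a + 1, b + 1, e, g] := by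
      ext i; fin_cases i <;> simp [-Matrix.cons_add, -Matrix.add_cons]
    have e2 : Finsupp.equivFunOnFinite.symm ![a, b, e, g] + Finsupp.single 2 1 +
        Finsupp.single 3 1 = Finsupp.equivFunOnFinite.symm ![a, b, e + 1, g + 1] := by
      ext i; fin_cases i <;> simp [-Matrix.cons_add, -Matrix.add_cons]
    rw [e1, e2] at this
    simp at this
    linear_combination this
  · have hev : (f p : ℂ) = eval (complexPoint p) Q := by
      rw [hQ, aeval_def, eval₂_map, hom_eval₂, ← hP]
      refine (eval₂_comp (algebraMap ℝ ℂ) p P).trans ?_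
      simp only [eval_complexPoint_complexSubst]
      congr 1
      ext x
      simp
    rw [hev, eval_eq']
    refine Finset.sum_of_injOn DFunLike.coe DFunLike.coe_injective.injOn ?_ ?_ ?_
    · intro s hs
      simp only [Finset.mem_coe, Fintype.mem_piFinset, Finset.mem_range] at hs ⊢
      intro i
      have h1 : ∑ i, s i = k := by
        rw [← Finsupp.degree_eq_sum]
        by_contra h
        exact (mem_support_iff.1 hs) (hQk.coeff_eq_zero h)
      have := Finset.single_le_sum (f := s) (fun i _ => Nat.zero_le _) (Finset.mem_univ i)
      omega
    · intro s _ hs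
      have h0 : coeff (Finsupp.equivFunOnFinite.symm s) Q = 0 :=
        notMem_support_iff.1 fun h => hs ⟨_, h, rfl⟩
      simp [h0]
    · intro s _
      congr 2
      ext; rfl

/-- The homogeneous Jacobi factor of `F k ℓ m`. -/
def radial (k : ℕ) (ℓ m : ℤ) (p : Fin 4 → ℝ) : ℝ :=
  ∑ i ∈ Finset.range (dd k ℓ m + 1),
    (Nat.choose (m.natAbs + dd k ℓ m) i : ℝ) *
    (Nat.choose (ℓ.natAbs + dd k ℓ m) (dd k ℓ m - i) : ℝ) *
    (p 0 ^ 2 + p 1 ^ 2) ^ i * (-(p 2 ^ 2 + p 3 ^ 2)) ^ (dd k ℓ m - i)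

/-- `u ^ L` for `L ≥ 0` and `w ^ |L|` for `L ≤ 0`. -/
def biPow (L : ℤ) (u w : ℂ) : ℂ := u ^ L.toNat * w ^ (-L).toNat

/-- The complex eigenmode of weight `(L, M)`. -/
def complexMode (k : ℕ) (L M : ℤ) (p : Fin 4 → ℝ) : ℂ :=
  radial k L M p * biPow L (complexPoint p 0) (complexPoint p 1) *
    biPow M (complexPoint p 2) (complexPoint p 3)

/-- The exponents of the `i`-th monomial of the mode of weight `(L, M)`. -/
def modeExponent (L M : ℤ) (d i : ℕ) : Fin 4 → ℕ :=
  ![L.toNat + i, (-L).toNat + i, M.toNat + (d - i), (-M).toNat + (d - i)]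

theorem toNat_succ_mul_toNat_neg_succ (L : ℤ) (i : ℕ) :
    ((L.toNat + i : ℕ) + 1 : ℂ) * (((-L).toNat + i : ℕ) + 1) = (i + 1) * (L.natAbs + i + 1) := by
  obtain h | h := le_total 0 L
  · have h1 : L.toNat = L.natAbs := by omega
    have h2 : (-L).toNat = 0 := by omega
    rw [h1, h2]; push_cast; ring
  · have h1 : (-L).toNat = L.natAbs := by omega
    have h2 : L.toNat = 0 := by omega
    rw [h1, h2]; push_cast; ring

theorem coeff_modeExponent {c : (Fin 4 → ℕ) → ℂ}
    (hc : ∀ a b e g : ℕ, (a + 1) * (b + 1) * c ![a + 1, b + 1, e, g] +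
      (e + 1) * (g + 1) * c ![a, b, e + 1, g + 1] = 0) (L M : ℤ) (d : ℕ) :
    ∀ i ≤ d, c (modeExponent L M d i) * ((Nat.choose (L.natAbs + d) d : ℂ) * (-1) ^ d) =
      c (modeExponent L M d 0) * (Nat.choose (M.natAbs + d) i *
        Nat.choose (L.natAbs + d) (d - i) * (-1) ^ (d - i)) := by
  intro i
  induction i with
  | zero => simp
  | succ i ih =>
    intro hi
    obtain ⟨j, rfl⟩ : ∃ j, d = i + 1 + j := ⟨d - (i + 1), by omega⟩
    have h := hc (L.toNat + i) ((-L).toNat + i) (M.toNat + j) ((-M).toNat + j)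
    rw [toNat_succ_mul_toNat_neg_succ, toNat_succ_mul_toNat_neg_succ] at h
    have ih := ih (by omega)
    have e1 : i + 1 + j - (i + 1) = j := by omega
    have e2 : i + 1 + j - i = j + 1 := by omega
    have c1 : ((M.natAbs + (i + 1 + j)).choose (i + 1) : ℂ) * (i + 1) =
        (M.natAbs + (i + 1 + j)).choose i * (M.natAbs + j + 1) := by
      have := Nat.choose_succ_right_eq (M.natAbs + (i + 1 + j)) i
      rw [show M.natAbs + (i + 1 + j) - i = M.natAbs + j + 1 by omega] at this
      exact_mod_cast this
    have c2 : ((L.natAbs + (i + 1 + j)).choose (j + 1) : ℂ) * (j + 1) =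
        (L.natAbs + (i + 1 + j)).choose j * (L.natAbs + i + 1) := by
      have := Nat.choose_succ_right_eq (L.natAbs + (i + 1 + j)) j
      rw [show L.natAbs + (i + 1 + j) - j = L.natAbs + i + 1 by omega] at this
      exact_mod_cast this
    have m1 : modeExponent L M (i + 1 + j) (i + 1) =
        ![L.toNat + i + 1, (-L).toNat + i + 1, M.toNat + j, (-M).toNat + j] := by
      simp only [modeExponent, e1]; rfl
    have m2 : modeExponent L M (i + 1 + j) i =
        ![L.toNat + i, (-L).toNat + i, M.toNat + j + 1, (-M).toNat + j + 1] := by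
      simp only [modeExponent, e2]; rfl
    rw [← m1, ← m2] at h
    rw [e2] at ih
    rw [e1]
    have hne : ((i + 1 : ℂ) * (L.natAbs + i + 1)) ≠ 0 := by
      norm_cast
    apply mul_left_cancel₀ hne
    rw [pow_succ] at ih
    generalize (Nat.choose (L.natAbs + (i + 1 + j)) (i + 1 + j) : ℂ) * (-1) ^ (i + 1 + j) = R at *
    generalize c (modeExponent L M (i + 1 + j) 0) = z at *
    linear_combination R * h - (j + 1) * (M.natAbs + j + 1) * ih -
      z * (-1) ^ j * (L.natAbs + i + 1) * (L.natAbs + (i + 1 + j)).choose j * c1 +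
      z * (-1) ^ j * (M.natAbs + (i + 1 + j)).choose i * (M.natAbs + j + 1) * c2

theorem modeExponent_term (L M : ℤ) (d i : ℕ) (p : Fin 4 → ℝ) :
    ∏ t, complexPoint p t ^ modeExponent L M d i t =
      ((p 0 ^ 2 + p 1 ^ 2 : ℝ) : ℂ) ^ i * ((p 2 ^ 2 + p 3 ^ 2 : ℝ) : ℂ) ^ (d - i) *
        biPow L (complexPoint p 0) (complexPoint p 1) *
        biPow M (complexPoint p 2) (complexPoint p 3) := by
  have h1 : ((p 0 ^ 2 + p 1 ^ 2 : ℝ) : ℂ) = complexPoint p 0 * complexPoint p 1 := by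
    simp [complexPoint]; ring_nf; simp
  have h2 : ((p 2 ^ 2 + p 3 ^ 2 : ℝ) : ℂ) = complexPoint p 2 * complexPoint p 3 := by
    simp [complexPoint]; ring_nf; simp
  rw [h1, h2, Fin.prod_univ_four]
  simp only [modeExponent, biPow, Matrix.cons_val, pow_add, mul_pow]
  ring

theorem sum_weight_eq {k : ℕ} {c : (Fin 4 → ℕ) → ℂ} (hc0 : ∀ s, ∑ i, s i ≠ k → c s = 0)
    (hc : ∀ a b e g : ℕ, (a + 1) * (b + 1) * c ![a + 1, b + 1, e, g] +
      (e + 1) * (g + 1) * c ![a, b, e + 1, g + 1] = 0) (L M : ℤ) :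
    ∃ κ : ℂ, (κ ≠ 0 → L.natAbs + M.natAbs ≤ k ∧ Int.ModEq 2 (L + M) k) ∧
      ∀ p, ∑ s ∈ Fintype.piFinset (fun _ : Fin 4 => Finset.range (k + 1)) with
        ((s 0 : ℤ) - s 1, (s 2 : ℤ) - s 3) = (L, M), c s * ∏ i, complexPoint p i ^ s i =
          κ * complexMode k L M p := by
  by_cases hv : L.natAbs + M.natAbs ≤ k ∧ Int.ModEq 2 (L + M) k
  · have hd : L.natAbs + M.natAbs + 2 * dd k L M = k := by
      have := hv.2
      unfold Int.ModEq at this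
      unfold dd
      omega
    generalize hdd : dd k L M = d at hd
    have hr : (Nat.choose (L.natAbs + d) d : ℂ) * (-1) ^ d ≠ 0 := by
      simp [Nat.choose_eq_zero_iff]
    refine ⟨c (modeExponent L M d 0) / ((Nat.choose (L.natAbs + d) d : ℂ) * (-1) ^ d),
      fun _ => hv, fun p => ?_⟩
    rw [complexMode, radial, hdd]
    push_cast
    rw [Finset.sum_mul, Finset.sum_mul, Finset.mul_sum]
    symm
    refine Finset.sum_of_injOn (modeExponent L M d) ?_ ?_ ?_ ?_
    · intro i _ j _ hij
      simpa [modeExponent] using congrFun hij 0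
    · intro i hi
      simp only [Finset.coe_range, Set.mem_Iio] at hi
      simp only [Finset.coe_filter, Fintype.mem_piFinset, Finset.mem_range, Set.mem_ofPred_eq,
        Prod.mk.injEq]
      refine ⟨fun t => ?_, ?_⟩
      · fin_cases t <;> simp [modeExponent] <;> omega
      · simp [modeExponent]
    · intro s hs hsi
      simp only [Finset.mem_filter, Fintype.mem_piFinset, Finset.mem_range, Prod.mk.injEq] at hs
      rw [hc0 s, zero_mul]
      intro hk
      rw [Fin.sum_univ_four] at hk
      refine hsi ⟨s 0 - L.toNat, ?_, ?_⟩
      · simp; omega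
      · ext t
        fin_cases t <;> simp [modeExponent] <;> omega
    · intro i hi
      rw [modeExponent_term]
      have h := coeff_modeExponent hc L M d i (by simp at hi; omega)
      rw [← eq_div_iff hr] at h
      push_cast
      rw [h, neg_pow ((p 2 : ℂ) ^ 2 + (p 3 : ℂ) ^ 2)]
      ring
  · refine ⟨0, fun h => absurd rfl h, fun p => ?_⟩
    rw [zero_mul]
    refine Finset.sum_eq_zero fun s hs => ?_
    simp only [Finset.mem_filter, Fintype.mem_piFinset, Finset.mem_range, Prod.mk.injEq] at hs
    rw [hc0 s, zero_mul]
    intro hk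
    rw [Fin.sum_univ_four] at hk
    apply hv
    unfold Int.ModEq
    omega

theorem exists_expansion {k : ℕ} {f : (Fin 4 → ℝ) → ℝ} (hf : IsHomogeneousPolyEval k f)
    (hh : IsHarmonic f) :
    ∃ (I : Finset (ℤ × ℤ)) (κ : ℤ × ℤ → ℂ),
      (∀ q, κ q ≠ 0 → q.1.natAbs + q.2.natAbs ≤ k ∧ Int.ModEq 2 (q.1 + q.2) k) ∧
      ∀ p, (f p : ℂ) = ∑ q ∈ I, κ q * complexMode k q.1 q.2 p := by
  obtain ⟨c, hc0, hc, hfc⟩ := exists_complex_coeff hf hh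
  choose κ hκ hκs using sum_weight_eq hc0 hc
  refine ⟨(Fintype.piFinset fun _ : Fin 4 => Finset.range (k + 1)).image
    fun s => ((s 0 : ℤ) - s 1, (s 2 : ℤ) - s 3), fun q => κ q.1 q.2, fun q => hκ q.1 q.2,
    fun p => ?_⟩
  rw [hfc p, ← Finset.sum_fiberwise_of_maps_to fun s hs => Finset.mem_image_of_mem
    (fun s : Fin 4 → ℕ => ((s 0 : ℤ) - s 1, (s 2 : ℤ) - s 3)) hs]
  exact Finset.sum_congr rfl fun q _ => hκs q.1 q.2 p

theorem radial_congr {k : ℕ} {ℓ m ℓ' m' : ℤ} (hℓ : ℓ.natAbs = ℓ'.natAbs)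
    (hm : m.natAbs = m'.natAbs) : radial k ℓ m = radial k ℓ' m' := by
  unfold radial dd
  rw [hℓ, hm]

theorem dd_congr {k : ℕ} {ℓ m ℓ' m' : ℤ} (hℓ : ℓ.natAbs = ℓ'.natAbs)
    (hm : m.natAbs = m'.natAbs) : dd k ℓ m = dd k ℓ' m' := by
  unfold dd
  rw [hℓ, hm]

theorem dd_swap (k : ℕ) (ℓ m : ℤ) : dd k m ℓ = dd k ℓ m := by
  unfold dd
  congr 1
  omega

theorem F_eq_radial (k : ℕ) (ℓ m : ℤ) (p : Fin 4 → ℝ) :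
    F k ℓ m p = radial k ℓ m p * circ ℓ (p 0) (p 1) * circ m (p 2) (p 3) := rfl

theorem radial_Amap (k : ℕ) (ℓ m : ℤ) (p : Fin 4 → ℝ) :
    radial k ℓ m (Amap p) = (-1) ^ dd k ℓ m * radial k m ℓ p := by
  unfold radial
  rw [dd_swap k ℓ m, ← Finset.sum_range_reflect, Finset.mul_sum]
  refine Finset.sum_congr rfl fun i hi => ?_
  have hi : i ≤ dd k ℓ m := by simp at hi; omega
  rw [show dd k ℓ m + 1 - 1 - i = dd k ℓ m - i by omega,
    show dd k ℓ m - (dd k ℓ m - i) = i by omega]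
  have h : (-1 : ℝ) ^ dd k ℓ m = (-1) ^ i * (-1) ^ (dd k ℓ m - i) := by
    rw [← pow_add]; congr 1; omega
  simp only [Amap, Matrix.cons_val]
  rw [h, neg_pow ((p 2) ^ 2 + (p 3) ^ 2), neg_pow ((-p 0) ^ 2 + (p 1) ^ 2), neg_sq, neg_sq]
  have h2 : ((-1 : ℝ) ^ (dd k ℓ m - i)) * (-1) ^ (dd k ℓ m - i) = 1 := by
    rw [← mul_pow]; simp
  linear_combination (-(-1 : ℝ) ^ i * ((m.natAbs + dd k ℓ m).choose (dd k ℓ m - i) : ℝ) *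
    ((ℓ.natAbs + dd k ℓ m).choose i : ℝ) * (p 0 ^ 2 + p 1 ^ 2) ^ i *
    (p 2 ^ 2 + p 3 ^ 2) ^ (dd k ℓ m - i)) * h2

theorem radial_Rrot (k : ℕ) (ℓ m : ℤ) (a b : ℝ) (p : Fin 4 → ℝ) :
    radial k ℓ m (Rrot a b p) = radial k ℓ m p := by
  have h1 : (Rrot a b p 0) ^ 2 + (Rrot a b p 1) ^ 2 = p 0 ^ 2 + p 1 ^ 2 := by
    simp only [Rrot, Matrix.cons_val]
    linear_combination (p 0 ^ 2 + p 1 ^ 2) * Real.sin_sq_add_cos_sq a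
  have h2 : (Rrot a b p 2) ^ 2 + (Rrot a b p 3) ^ 2 = p 2 ^ 2 + p 3 ^ 2 := by
    simp only [Rrot, Matrix.cons_val]
    linear_combination (p 2 ^ 2 + p 3 ^ 2) * Real.sin_sq_add_cos_sq b
  unfold radial
  rw [h1, h2]

theorem biPow_neg (L : ℤ) (u w : ℂ) : biPow (-L) u w = biPow L w u := by
  simp [biPow, mul_comm]

theorem biPow_neg_neg (L : ℤ) (u w : ℂ) : biPow L (-u) (-w) = (-1) ^ L.natAbs * biPow L u w := by
  have : L.natAbs = L.toNat + (-L).toNat := by omega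
  rw [this]
  simp only [biPow]
  rw [neg_pow u, neg_pow w, pow_add]
  ring

theorem biPow_mul {ζ : ℂ} (hζ : ζ ≠ 0) (L : ℤ) (u w : ℂ) :
    biPow L (ζ * u) (ζ⁻¹ * w) = ζ ^ L * biPow L u w := by
  have : ζ ^ L = ζ ^ L.toNat * ζ⁻¹ ^ (-L).toNat := by
    conv_lhs => rw [← Int.toNat_sub_toNat_neg L]
    rw [zpow_sub₀ hζ, zpow_natCast, zpow_natCast, inv_pow, div_eq_mul_inv]
  rw [this, biPow, biPow, mul_pow, mul_pow]
  ring

theorem conj_biPow (L : ℤ) (u w : ℂ) :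
    (starRingEnd ℂ) (biPow L u w) = biPow L (starRingEnd ℂ u) (starRingEnd ℂ w) := by
  simp [biPow]

theorem conj_complexPoint_zero (p : Fin 4 → ℝ) :
    (starRingEnd ℂ) (complexPoint p 0) = complexPoint p 1 := by
  simp [complexPoint, sub_eq_add_neg]

theorem conj_complexPoint_two (p : Fin 4 → ℝ) :
    (starRingEnd ℂ) (complexPoint p 2) = complexPoint p 3 := by
  simp [complexPoint, sub_eq_add_neg]

theorem complexMode_neg_neg (k : ℕ) (L M : ℤ) (p : Fin 4 → ℝ) :
    complexMode k (-L) (-M) p = (starRingEnd ℂ) (complexMode k L M p) := by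
  simp only [complexMode, map_mul, conj_biPow, Complex.conj_ofReal, biPow_neg]
  rw [radial_congr (Int.natAbs_neg L) (Int.natAbs_neg M), ← conj_complexPoint_zero,
    ← conj_complexPoint_two, Complex.conj_conj, Complex.conj_conj]

theorem complexMode_Rrot (k : ℕ) (L M : ℤ) (a : ℝ) (p : Fin 4 → ℝ) :
    complexMode k L M (Rrot a a p) =
      Complex.exp (a * Complex.I) ^ (L + M) * complexMode k L M p := by
  have hne := Complex.exp_ne_zero (a * Complex.I)
  have hinv : (Complex.exp (a * Complex.I))⁻¹ = Complex.cos a - Complex.sin a * Complex.I := by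
    rw [← Complex.exp_neg, ← neg_mul, ← Complex.ofReal_neg, Complex.exp_mul_I]
    simp [sub_eq_add_neg]
  have h0 : complexPoint (Rrot a a p) 0 = Complex.exp (a * Complex.I) * complexPoint p 0 := by
    rw [Complex.exp_mul_I]
    simp [complexPoint, Rrot]
    linear_combination -(p 1 : ℂ) * Complex.sin a * Complex.I_sq
  have h1 : complexPoint (Rrot a a p) 1 = (Complex.exp (a * Complex.I))⁻¹ * complexPoint p 1 := by
    rw [hinv]
    simp [complexPoint, Rrot]
    linear_combination -(p 1 : ℂ) * Complex.sin a * Complex.I_sq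
  have h2 : complexPoint (Rrot a a p) 2 = Complex.exp (a * Complex.I) * complexPoint p 2 := by
    rw [Complex.exp_mul_I]
    simp [complexPoint, Rrot]
    linear_combination -(p 3 : ℂ) * Complex.sin a * Complex.I_sq
  have h3 : complexPoint (Rrot a a p) 3 = (Complex.exp (a * Complex.I))⁻¹ * complexPoint p 3 := by
    rw [hinv]
    simp [complexPoint, Rrot]
    linear_combination -(p 3 : ℂ) * Complex.sin a * Complex.I_sq
  rw [complexMode, complexMode, radial_Rrot, h0, h1, h2, h3, biPow_mul hne, biPow_mul hne,
    zpow_add₀ hne]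
  ring

theorem complexMode_Amap (k : ℕ) (L M : ℤ) (p : Fin 4 → ℝ) :
    complexMode k L M (Amap p) =
      (-1) ^ (dd k L M + M.natAbs) * complexMode k (-M) (-L) p := by
  have h0 : complexPoint (Amap p) 0 = complexPoint p 3 := by
    simp [complexPoint, Amap, sub_eq_add_neg]
  have h1 : complexPoint (Amap p) 1 = complexPoint p 2 := by
    simp [complexPoint, Amap]
  have h2 : complexPoint (Amap p) 2 = -complexPoint p 1 := by
    simp [complexPoint, Amap]; ring
  have h3 : complexPoint (Amap p) 3 = -complexPoint p 0 := by
    simp [complexPoint, Amap]; ring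
  rw [complexMode, complexMode, h0, h1, h2, h3, radial_Amap, biPow_neg_neg, biPow_neg, biPow_neg,
    radial_congr (Int.natAbs_neg M) (Int.natAbs_neg L), pow_add]
  push_cast
  ring

/-- The symmetrization of `complexMode k L M` under `Amap`, up to a factor of two. -/
def symMode (k : ℕ) (L M : ℤ) (p : Fin 4 → ℝ) : ℂ :=
  complexMode k L M p + (-1) ^ (dd k L M + M.natAbs) * complexMode k (-M) (-L) p

theorem symMode_Amap {k : ℕ} {L M : ℤ} (h : Even (L + M)) (p : Fin 4 → ℝ) :
    symMode k L M (Amap p) = symMode k L M p := by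
  have hd : dd k (-M) (-L) = dd k L M := by
    rw [dd_congr (Int.natAbs_neg M) (Int.natAbs_neg L), dd_swap]
  have hs : (-1 : ℂ) ^ (dd k L M + M.natAbs) * (-1) ^ (dd k L M + L.natAbs) = 1 := by
    rw [← pow_add]
    apply Even.neg_one_pow
    rw [Int.even_iff] at h
    rw [Nat.even_iff]
    omega
  rw [symMode, complexMode_Amap, complexMode_Amap, symMode, hd, Int.natAbs_neg, neg_neg, neg_neg,
    ← mul_assoc, hs]
  ring

theorem exp_pi_div_zpow_eq_one_iff {n : ℤ} (hn : 1 ≤ n) (j : ℤ) :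
    Complex.exp ((Real.pi / n : ℝ) * Complex.I) ^ j = 1 ↔ Int.ModEq (2 * n) j 0 := by
  have hn' : (n : ℂ) ≠ 0 := by exact_mod_cast (by omega : n ≠ 0)
  have hpi : (Real.pi : ℂ) ≠ 0 := by exact_mod_cast Real.pi_ne_zero
  rw [← Complex.exp_int_mul, Complex.exp_eq_one_iff, Int.modEq_zero_iff_dvd]
  refine exists_congr fun t => ?_
  have : (j : ℂ) * ((Real.pi / n : ℝ) * Complex.I) = t * (2 * Real.pi * Complex.I) ↔
      (j : ℂ) = 2 * n * t := by
    push_cast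
    constructor
    · intro h
      field_simp at h
      linear_combination h
    · intro h
      rw [h]
      field_simp
  rw [this]
  norm_cast

theorem symMode_Rrot {n : ℤ} (hn : 1 ≤ n) {k : ℕ} {L M : ℤ} (h : Int.ModEq (2 * n) (L + M) 0)
    (p : Fin 4 → ℝ) :
    symMode k L M (Rrot (Real.pi / n) (Real.pi / n) p) = symMode k L M p := by
  have h' : Int.ModEq (2 * n) (-M + -L) 0 := by
    rw [Int.modEq_zero_iff_dvd] at h ⊢
    rw [show -M + -L = -(L + M) by ring]
    exact h.neg_right
  rw [symMode, complexMode_Rrot, complexMode_Rrot, (exp_pi_div_zpow_eq_one_iff hn _).2 h,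
    (exp_pi_div_zpow_eq_one_iff hn _).2 h', one_mul, one_mul, symMode]

theorem symMode_neg_neg (k : ℕ) (L M : ℤ) (p : Fin 4 → ℝ) :
    symMode k (-L) (-M) p = (starRingEnd ℂ) (symMode k L M p) := by
  simp only [symMode, map_add, map_mul, map_pow, map_neg, map_one]
  rw [complexMode_neg_neg, complexMode_neg_neg k (-M) (-L), dd_congr (Int.natAbs_neg L)
    (Int.natAbs_neg M), Int.natAbs_neg]

theorem symMode_neg_swap {k : ℕ} {L M : ℤ} (h : Even (L + M)) (p : Fin 4 → ℝ) :
    symMode k (-M) (-L) p = (-1) ^ (dd k L M + M.natAbs) * symMode k L M p := by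
  have hd : dd k (-M) (-L) = dd k L M := by
    rw [dd_congr (Int.natAbs_neg M) (Int.natAbs_neg L), dd_swap]
  have hs : (-1 : ℂ) ^ (dd k L M + M.natAbs) * (-1) ^ (dd k L M + M.natAbs) = 1 := by
    rw [← mul_pow]; simp
  have he : (-1 : ℂ) ^ (dd k L M + L.natAbs) = (-1) ^ (dd k L M + M.natAbs) := by
    apply neg_one_pow_congr
    rw [Int.even_iff] at h
    rw [Nat.even_iff, Nat.even_iff]
    omega
  rw [symMode, symMode, hd, Int.natAbs_neg, neg_neg, neg_neg, he, mul_add, ← mul_assoc, hs]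
  ring

theorem biPow_eq_circ {a : ℤ} (ha : 0 < a) (u w : ℝ) (z : ℂ) :
    biPow a (u + w * Complex.I) z = circ a u w + circ (-a) u w * Complex.I := by
  have h1 : a.toNat = a.natAbs := by omega
  have h2 : (-a).toNat = 0 := by omega
  rw [biPow, h1, h2, pow_zero, mul_one, circ, circ, if_pos ha.le, if_neg (by omega),
    Int.natAbs_neg, Complex.re_add_im]

theorem biPow_neg_eq_circ {a : ℤ} (ha : 0 < a) (u w : ℝ) (z : ℂ) :
    biPow (-a) z (u - w * Complex.I) = circ a u w - circ (-a) u w * Complex.I := by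
  have h := congrArg (starRingEnd ℂ) (biPow_eq_circ ha u w ((starRingEnd ℂ) z))
  rw [biPow_neg]
  rw [conj_biPow] at h
  simpa [← sub_eq_add_neg] using h

theorem biPow_zero (u w : ℂ) : biPow 0 u w = 1 := by simp [biPow]

theorem circ_zero (u w : ℝ) : circ 0 u w = 1 := by simp [circ]

theorem complexMode_zero_zero (k : ℕ) (p : Fin 4 → ℝ) : complexMode k 0 0 p = F k 0 0 p := by
  simp [complexMode, F_eq_radial, biPow_zero, circ_zero]

theorem complexMode_pos_zero (k : ℕ) {a : ℤ} (ha : 0 < a) (p : Fin 4 → ℝ) :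
    complexMode k a 0 p = F k a 0 p + F k (-a) 0 p * Complex.I := by
  rw [complexMode, F_eq_radial, F_eq_radial, radial_congr (Int.natAbs_neg a) rfl]
  simp only [complexPoint, Matrix.cons_val]
  rw [biPow_eq_circ ha, biPow_zero, circ_zero]
  push_cast
  ring

theorem complexMode_zero_pos (k : ℕ) {b : ℤ} (hb : 0 < b) (p : Fin 4 → ℝ) :
    complexMode k 0 b p = F k 0 b p + F k 0 (-b) p * Complex.I := by
  rw [complexMode, F_eq_radial, F_eq_radial, radial_congr rfl (Int.natAbs_neg b)]
  simp only [complexPoint, Matrix.cons_val]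
  rw [biPow_eq_circ hb, biPow_zero, circ_zero]
  push_cast
  ring

theorem complexMode_pos_pos (k : ℕ) {a b : ℤ} (ha : 0 < a) (hb : 0 < b) (p : Fin 4 → ℝ) :
    complexMode k a b p = (F k a b p - F k (-a) (-b) p) +
      (F k a (-b) p + F k (-a) b p) * Complex.I := by
  simp only [complexMode, F_eq_radial, radial_congr (Int.natAbs_neg a) rfl,
    radial_congr rfl (Int.natAbs_neg b)]
  simp only [complexPoint, Matrix.cons_val]
  rw [biPow_eq_circ ha, biPow_eq_circ hb]
  push_cast
  linear_combination (radial k a b p * circ (-a) (p 0) (p 1) * circ (-b) (p 2) (p 3) : ℂ) *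
    Complex.I_sq

theorem complexMode_pos_neg (k : ℕ) {a b : ℤ} (ha : 0 < a) (hb : 0 < b) (p : Fin 4 → ℝ) :
    complexMode k a (-b) p = (F k a b p + F k (-a) (-b) p) +
      (F k (-a) b p - F k a (-b) p) * Complex.I := by
  simp only [complexMode, F_eq_radial, radial_congr (Int.natAbs_neg a) rfl,
    radial_congr rfl (Int.natAbs_neg b)]
  simp only [complexPoint, Matrix.cons_val]
  rw [biPow_eq_circ ha, biPow_neg_eq_circ hb]
  push_cast
  linear_combination (-radial k a b p * circ (-a) (p 0) (p 1) * circ (-b) (p 2) (p 3) : ℂ) *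
    Complex.I_sq

/-- The real part of `symMode`. -/
def reMode (k : ℕ) (L M : ℤ) (p : Fin 4 → ℝ) : ℝ := (symMode k L M p).re

/-- The imaginary part of `symMode`. -/
def imMode (k : ℕ) (L M : ℤ) (p : Fin 4 → ℝ) : ℝ := (symMode k L M p).im

theorem re_symMode_and_im_symMode {k : ℕ} {L M : ℤ} {s : ℝ}
    (hs : (-1 : ℝ) ^ (dd k L M + M.natAbs) = s) {r i r' i' : (Fin 4 → ℝ) → ℝ}
    (h : ∀ p, complexMode k L M p = r p + i p * Complex.I)
    (h' : ∀ p, complexMode k (-M) (-L) p = r' p + i' p * Complex.I) :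
    reMode k L M = r + s • r' ∧ imMode k L M = i + s • i' := by
  have hs' : (-1 : ℂ) ^ (dd k L M + M.natAbs) = (s : ℂ) := by rw [← hs]; push_cast; rfl
  constructor <;> funext p <;> simp [reMode, imMode, symMode, hs', h, h']

theorem modes_zero_zero {k : ℕ} {s : ℝ} (hs : (-1 : ℝ) ^ dd k 0 0 = s) :
    reMode k 0 0 = F k 0 0 + s • F k 0 0 ∧ imMode k 0 0 = 0 := by
  have := re_symMode_and_im_symMode (k := k) (L := 0) (M := 0) (i := 0) (i' := 0) (s := s)
    (by simpa using hs) (r := F k 0 0) (r' := F k 0 0)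
    (by simp [complexMode_zero_zero]) (by simp [complexMode_zero_zero])
  simpa using this

theorem modes_pos_zero {k : ℕ} {a : ℤ} (ha : 0 < a) {s : ℝ} (hs : (-1 : ℝ) ^ dd k a 0 = s) :
    reMode k a 0 = F k a 0 + s • F k 0 a ∧ imMode k a 0 = F k (-a) 0 + s • -F k 0 (-a) := by
  refine re_symMode_and_im_symMode (by simpa using hs) (complexMode_pos_zero k ha) fun p => ?_
  rw [complexMode_neg_neg, complexMode_zero_pos k ha]
  simp

theorem modes_pos_pos {k : ℕ} {a b : ℤ} (ha : 0 < a) (hb : 0 < b) {s : ℝ}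
    (hs : (-1 : ℝ) ^ (dd k a b + b.natAbs) = s) :
    reMode k a b = (F k a b - F k (-a) (-b)) + s • (F k b a - F k (-b) (-a)) ∧
    imMode k a b = (F k a (-b) + F k (-a) b) + s • -(F k (-b) a + F k b (-a)) := by
  refine re_symMode_and_im_symMode hs (fun p => ?_) fun p => ?_
  · rw [complexMode_pos_pos k ha hb]
    simp
  · rw [complexMode_neg_neg, complexMode_pos_pos k hb ha]
    simp
    ring

theorem modes_pos_neg {k : ℕ} {a b : ℤ} (ha : 0 < a) (hb : 0 < b) {s : ℝ}
    (hs : (-1 : ℝ) ^ (dd k a b + b.natAbs) = s) :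
    reMode k a (-b) = (F k a b + F k (-a) (-b)) + s • (F k b a + F k (-b) (-a)) ∧
    imMode k a (-b) = (F k (-a) b - F k a (-b)) + s • (F k (-b) a - F k b (-a)) := by
  refine re_symMode_and_im_symMode ?_ (fun p => ?_) fun p => ?_
  · rwa [dd_congr rfl (Int.natAbs_neg b), Int.natAbs_neg]
  · rw [complexMode_pos_neg k ha hb]
    simp
  · rw [neg_neg, complexMode_pos_neg k hb ha]
    simp

theorem sgn_of_pos (k : ℕ) {ℓ m : ℤ} (hℓ : 0 < ℓ) (hm : 0 < m) :
    sgn k ℓ m = (-1) ^ (dd k ℓ m + m.natAbs) := by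
  have h (j : ℕ) : (-1 : ℝ) ^ j = if Even j then 1 else -1 := by
    split_ifs with hj
    · exact hj.neg_one_pow
    · exact (Nat.not_even_iff_odd.1 hj).neg_one_pow
  rw [sgn, pow_add, h, h, if_pos hℓ.le, if_pos hm.le, mul_one, mul_one]
  simp only [Int.natAbs_even]

theorem neg_one_pow_dd_self {k : ℕ} {a : ℤ} (hle : a.natAbs + a.natAbs ≤ k)
    (hpar : Int.ModEq 2 (a + a) k) :
    (-1 : ℝ) ^ (dd k a a + a.natAbs) = if k % 4 = 0 then 1 else -1 := by
  unfold Int.ModEq at hpar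
  split_ifs with h
  · apply Even.neg_one_pow
    rw [Nat.even_iff, dd]
    omega
  · apply Odd.neg_one_pow
    rw [Nat.odd_iff, dd]
    omega

theorem Int.modEq_iff_sub_modEq_zero {N a b : ℤ} : Int.ModEq N a b ↔ Int.ModEq N (a + -b) 0 := by
  rw [Int.modEq_iff_dvd, Int.modEq_zero_iff_dvd, dvd_sub_comm, sub_eq_add_neg]

/-- The weights of the complex eigenmodes of degree `k` fixed by `R(π/n, π/n)`. -/
def IsInvariantWeight (n : ℤ) (k : ℕ) (L M : ℤ) : Prop :=
  L.natAbs + M.natAbs ≤ k ∧ Int.ModEq 2 (L + M) k ∧ Int.ModEq (2 * n) (L + M) 0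

/-- The real and imaginary parts of the symmetrized modes of invariant weight. -/
def symModes (n : ℤ) (k : ℕ) : Set ((Fin 4 → ℝ) → ℝ) :=
  {h | ∃ L M, IsInvariantWeight n k L M ∧ (h = reMode k L M ∨ h = imMode k L M)}

/-- The listed eigenmodes. -/
def invariantModes (n : ℤ) (k : ℕ) : Set ((Fin 4 → ℝ) → ℝ) :=
  {h : (Fin 4 → ℝ) → ℝ |
      (Int.ModEq 2 0 k ∧ k % 4 = 0 ∧ h = F k 0 0) ∨
      (∃ ℓ : ℤ, 0 < ℓ ∧ ℓ.natAbs ≤ k ∧ Int.ModEq 2 ℓ k ∧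
        Int.ModEq (2 * n) ℓ 0 ∧ Even (dd k ℓ 0) ∧
        (h = F k ℓ 0 + F k 0 ℓ ∨ h = F k (-ℓ) 0 - F k 0 (-ℓ))) ∨
      (∃ ℓ : ℤ, 0 < ℓ ∧ ℓ.natAbs ≤ k ∧ Int.ModEq 2 ℓ k ∧
        Int.ModEq (2 * n) ℓ 0 ∧ ¬ Even (dd k ℓ 0) ∧
        (h = F k ℓ 0 - F k 0 ℓ ∨ h = F k (-ℓ) 0 + F k 0 (-ℓ))) ∨
      (∃ ℓ : ℤ, 0 < ℓ ∧ ℓ.natAbs + ℓ.natAbs ≤ k ∧ Int.ModEq 2 (ℓ + ℓ) k ∧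
        k % 4 = 0 ∧
        (h = F k ℓ ℓ + F k (-ℓ) (-ℓ) ∨ h = F k (-ℓ) ℓ - F k ℓ (-ℓ))) ∨
      (∃ ℓ : ℤ, 0 < ℓ ∧ ℓ.natAbs + ℓ.natAbs ≤ k ∧ Int.ModEq 2 (ℓ + ℓ) k ∧
        Int.ModEq (2 * n) (2 * ℓ) 0 ∧ k % 4 = 0 ∧
        h = F k ℓ ℓ - F k (-ℓ) (-ℓ)) ∨
      (∃ ℓ : ℤ, 0 < ℓ ∧ ℓ.natAbs + ℓ.natAbs ≤ k ∧ Int.ModEq 2 (ℓ + ℓ) k ∧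
        Int.ModEq (2 * n) (2 * ℓ) 0 ∧ k % 4 = 2 ∧
        h = F k (-ℓ) ℓ + F k ℓ (-ℓ)) ∨
      (∃ ℓ m : ℤ, 0 < ℓ ∧ 0 < m ∧ ℓ ≠ m ∧ ℓ.natAbs + m.natAbs ≤ k ∧
        Int.ModEq 2 (ℓ + m) k ∧ Int.ModEq (2 * n) ℓ m ∧ sgn k ℓ m = 1 ∧
        (h = (F k ℓ m + F k (-ℓ) (-m)) + (F k m ℓ + F k (-m) (-ℓ)) ∨
         h = (F k ℓ (-m) - F k (-ℓ) m) - (F k (-m) ℓ - F k m (-ℓ)))) ∨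
      (∃ ℓ m : ℤ, 0 < ℓ ∧ 0 < m ∧ ℓ ≠ m ∧ ℓ.natAbs + m.natAbs ≤ k ∧
        Int.ModEq 2 (ℓ + m) k ∧ Int.ModEq (2 * n) ℓ m ∧ sgn k ℓ m = -1 ∧
        (h = (F k ℓ m + F k (-ℓ) (-m)) - (F k m ℓ + F k (-m) (-ℓ)) ∨
         h = (F k ℓ (-m) - F k (-ℓ) m) + (F k (-m) ℓ - F k m (-ℓ)))) ∨
      (∃ ℓ m : ℤ, 0 < ℓ ∧ 0 < m ∧ ℓ ≠ m ∧ ℓ.natAbs + m.natAbs ≤ k ∧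
        Int.ModEq 2 (ℓ + m) k ∧ Int.ModEq (2 * n) ℓ (-m) ∧ sgn k ℓ m = 1 ∧
        (h = (F k ℓ m - F k (-ℓ) (-m)) + (F k m ℓ - F k (-m) (-ℓ)) ∨
         h = (F k ℓ (-m) + F k (-ℓ) m) - (F k (-m) ℓ + F k m (-ℓ)))) ∨
      (∃ ℓ m : ℤ, 0 < ℓ ∧ 0 < m ∧ ℓ ≠ m ∧ ℓ.natAbs + m.natAbs ≤ k ∧
        Int.ModEq 2 (ℓ + m) k ∧ Int.ModEq (2 * n) ℓ (-m) ∧ sgn k ℓ m = -1 ∧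
        (h = (F k ℓ m - F k (-ℓ) (-m)) - (F k m ℓ - F k (-m) (-ℓ)) ∨
         h = (F k ℓ (-m) + F k (-ℓ) m) + (F k (-m) ℓ + F k m (-ℓ))))}

theorem IsInvariantWeight.reMode_mem {n : ℤ} {k : ℕ} {L M : ℤ} (h : IsInvariantWeight n k L M) :
    reMode k L M ∈ Submodule.span ℝ (symModes n k) :=
  Submodule.subset_span ⟨L, M, h, Or.inl rfl⟩

theorem IsInvariantWeight.imMode_mem {n : ℤ} {k : ℕ} {L M : ℤ} (h : IsInvariantWeight n k L M) :
    imMode k L M ∈ Submodule.span ℝ (symModes n k) :=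
  Submodule.subset_span ⟨L, M, h, Or.inr rfl⟩

theorem invariantModes_subset (n : ℤ) (k : ℕ) :
    invariantModes n k ⊆ Submodule.span ℝ (symModes n k) := by
  have half {V : Submodule ℝ ((Fin 4 → ℝ) → ℝ)} {g h : (Fin 4 → ℝ) → ℝ} (hg : g ∈ V)
      (e : g = h + (1 : ℝ) • h) : h ∈ V := by
    have : h = (1 / 2 : ℝ) • g := by rw [e]; module
    rw [this]
    exact V.smul_mem _ hg
  have eqv {V : Submodule ℝ ((Fin 4 → ℝ) → ℝ)} {g h : (Fin 4 → ℝ) → ℝ} (hg : g ∈ V)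
      (e : h = g) : h ∈ V := e ▸ hg
  have neg {V : Submodule ℝ ((Fin 4 → ℝ) → ℝ)} {g h : (Fin 4 → ℝ) → ℝ} (hg : g ∈ V)
      (e : h = -g) : h ∈ V := e ▸ V.neg_mem hg
  rintro h (⟨hp, hk, rfl⟩ | ⟨ℓ, h0, hle, hp, hn, hd, hh⟩ | ⟨ℓ, h0, hle, hp, hn, hd, hh⟩ |
    ⟨ℓ, h0, hle, hp, hk, hh⟩ | ⟨ℓ, h0, hle, hp, hn, hk, rfl⟩ | ⟨ℓ, h0, hle, hp, hn, hk, rfl⟩ |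
    ⟨ℓ, m, h0, h0', -, hle, hp, hn, hs, hh⟩ | ⟨ℓ, m, h0, h0', -, hle, hp, hn, hs, hh⟩ |
    ⟨ℓ, m, h0, h0', -, hle, hp, hn, hs, hh⟩ | ⟨ℓ, m, h0, h0', -, hle, hp, hn, hs, hh⟩)
  · have hw : IsInvariantWeight n k 0 0 := ⟨by simp, by simpa using hp, by simp⟩
    have hs : (-1 : ℝ) ^ dd k 0 0 = 1 := by
      apply Even.neg_one_pow
      rw [Nat.even_iff, dd]
      simp
      omega
    exact half hw.reMode_mem (modes_zero_zero hs).1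
  · have hw : IsInvariantWeight n k ℓ 0 := ⟨by simpa using hle, by simpa using hp, by simpa using hn⟩
    have e := modes_pos_zero h0 hd.neg_one_pow
    obtain rfl | rfl := hh
    · refine eqv hw.reMode_mem ?_
      rw [e.1]; module
    · refine eqv hw.imMode_mem ?_
      rw [e.2]; module
  · have hw : IsInvariantWeight n k ℓ 0 := ⟨by simpa using hle, by simpa using hp, by simpa using hn⟩
    have e := modes_pos_zero h0 (Nat.not_even_iff_odd.1 hd).neg_one_pow
    obtain rfl | rfl := hh
    · refine eqv hw.reMode_mem ?_
      rw [e.1]; module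
    · refine eqv hw.imMode_mem ?_
      rw [e.2]; module
  · have hw : IsInvariantWeight n k ℓ (-ℓ) :=
      ⟨by simpa using hle, by unfold Int.ModEq at *; omega, by simp⟩
    have e := modes_pos_neg h0 h0 ((neg_one_pow_dd_self hle hp).trans (if_pos hk))
    obtain rfl | rfl := hh
    · exact half hw.reMode_mem e.1
    · exact half hw.imMode_mem e.2
  · have hw : IsInvariantWeight n k ℓ ℓ := ⟨hle, hp, by rwa [← two_mul]⟩
    have e := modes_pos_pos h0 h0 ((neg_one_pow_dd_self hle hp).trans (if_pos hk))
    exact half hw.reMode_mem e.1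
  · have hw : IsInvariantWeight n k ℓ ℓ := ⟨hle, hp, by rwa [← two_mul]⟩
    have e := modes_pos_pos h0 h0 ((neg_one_pow_dd_self hle hp).trans (if_neg (by omega)))
    refine half hw.imMode_mem (e.2.trans ?_)
    module
  all_goals rw [sgn_of_pos k h0 h0'] at hs
  · have hw : IsInvariantWeight n k ℓ (-m) := ⟨by simpa using hle,
      by unfold Int.ModEq at *; omega, Int.modEq_iff_sub_modEq_zero.1 hn⟩
    have e := modes_pos_neg h0 h0' hs
    obtain rfl | rfl := hh
    · refine eqv hw.reMode_mem ?_
      rw [e.1]; module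
    · refine neg hw.imMode_mem ?_
      rw [e.2]; module
  · have hw : IsInvariantWeight n k ℓ (-m) := ⟨by simpa using hle,
      by unfold Int.ModEq at *; omega, Int.modEq_iff_sub_modEq_zero.1 hn⟩
    have e := modes_pos_neg h0 h0' hs
    obtain rfl | rfl := hh
    · refine eqv hw.reMode_mem ?_
      rw [e.1]; module
    · refine neg hw.imMode_mem ?_
      rw [e.2]; module
  · have hw : IsInvariantWeight n k ℓ m :=
      ⟨hle, hp, by simpa using Int.modEq_iff_sub_modEq_zero.1 hn⟩
    have e := modes_pos_pos h0 h0' hs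
    obtain rfl | rfl := hh
    · refine eqv hw.reMode_mem ?_
      rw [e.1]; module
    · refine eqv hw.imMode_mem ?_
      rw [e.2]; module
  · have hw : IsInvariantWeight n k ℓ m :=
      ⟨hle, hp, by simpa using Int.modEq_iff_sub_modEq_zero.1 hn⟩
    have e := modes_pos_pos h0 h0' hs
    obtain rfl | rfl := hh
    · refine eqv hw.reMode_mem ?_
      rw [e.1]; module
    · refine eqv hw.imMode_mem ?_
      rw [e.2]; module

/-- The weights whose symmetrized modes lie in the span of the listed eigenmodes. -/
def IsSpanned (n : ℤ) (k : ℕ) (L M : ℤ) : Prop :=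
  reMode k L M ∈ Submodule.span ℝ (invariantModes n k) ∧
    imMode k L M ∈ Submodule.span ℝ (invariantModes n k)

theorem IsSpanned.neg_neg {n : ℤ} {k : ℕ} {L M : ℤ} (h : IsSpanned n k (-L) (-M)) :
    IsSpanned n k L M := by
  have e1 : reMode k L M = reMode k (-L) (-M) := by
    funext p
    simp [reMode, symMode_neg_neg k L M]
  have e2 : imMode k L M = -imMode k (-L) (-M) := by
    funext p
    simp [imMode, symMode_neg_neg k L M]
  exact ⟨e1 ▸ h.1, e2 ▸ Submodule.neg_mem _ h.2⟩

theorem IsSpanned.neg_swap {n : ℤ} {k : ℕ} {L M : ℤ} (hLM : Even (L + M))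
    (h : IsSpanned n k L M) : IsSpanned n k (-M) (-L) := by
  have hs : (-1 : ℂ) ^ (dd k L M + M.natAbs) = ((-1 : ℝ) ^ (dd k L M + M.natAbs) : ℝ) := by
    push_cast; rfl
  have e1 : reMode k (-M) (-L) = (-1 : ℝ) ^ (dd k L M + M.natAbs) • reMode k L M := by
    funext p
    simp only [reMode, symMode_neg_swap hLM, hs, Complex.re_ofReal_mul, Pi.smul_apply, smul_eq_mul]
  have e2 : imMode k (-M) (-L) = (-1 : ℝ) ^ (dd k L M + M.natAbs) • imMode k L M := by
    funext p
    simp only [imMode, symMode_neg_swap hLM, hs, Complex.im_ofReal_mul, Pi.smul_apply, smul_eq_mul]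
  exact ⟨e1 ▸ Submodule.smul_mem _ _ h.1, e2 ▸ Submodule.smul_mem _ _ h.2⟩

theorem isSpanned_of_eq {n : ℤ} {k : ℕ} {L M : ℤ} {r i : (Fin 4 → ℝ) → ℝ} {c c' : ℝ}
    (h : reMode k L M = c • r ∧ imMode k L M = c' • i)
    (hr : c = 0 ∨ r ∈ invariantModes n k) (hi : c' = 0 ∨ i ∈ invariantModes n k) :
    IsSpanned n k L M := by
  rw [IsSpanned, h.1, h.2]
  constructor
  · obtain rfl | hr := hr
    · simp
    · exact Submodule.smul_mem _ _ (Submodule.subset_span hr)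
  · obtain rfl | hi := hi
    · simp
    · exact Submodule.smul_mem _ _ (Submodule.subset_span hi)

theorem neg_one_pow_cases (j : ℕ) :
    Even j ∧ (-1 : ℝ) ^ j = 1 ∨ ¬ Even j ∧ (-1 : ℝ) ^ j = -1 := by
  rcases Nat.even_or_odd j with h | h
  · exact Or.inl ⟨h, h.neg_one_pow⟩
  · exact Or.inr ⟨Nat.not_even_iff_odd.2 h, h.neg_one_pow⟩

theorem isSpanned_zero_zero {n : ℤ} {k : ℕ} (hw : IsInvariantWeight n k 0 0) :
    IsSpanned n k 0 0 := by
  obtain ⟨-, hp, -⟩ := hw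
  have hp' : Int.ModEq 2 0 k := by simpa using hp
  obtain ⟨hd, hs⟩ | ⟨hd, hs⟩ := neg_one_pow_cases (dd k 0 0) <;> have e := modes_zero_zero hs <;>
    rw [Nat.even_iff, dd] at hd
  · have hk : k % 4 = 0 := by unfold Int.ModEq at hp'; simp at hd; omega
    refine isSpanned_of_eq (c := 2) (c' := 0) (r := F k 0 0) (i := 0) ⟨?_, ?_⟩
      (Or.inr (Or.inl ⟨hp', hk, rfl⟩)) (Or.inl rfl)
    · rw [e.1]; module
    · rw [e.2]; module
  · refine isSpanned_of_eq (c := 0) (c' := 0) (r := 0) (i := 0) ⟨?_, ?_⟩ (Or.inl rfl) (Or.inl rfl)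
    · rw [e.1]; module
    · rw [e.2]; module

theorem isSpanned_pos_zero {n : ℤ} {k : ℕ} {a : ℤ} (ha : 0 < a)
    (hw : IsInvariantWeight n k a 0) : IsSpanned n k a 0 := by
  obtain ⟨hle, hp, hn⟩ := hw
  rw [add_zero] at hp hn
  have hle' : a.natAbs ≤ k := by simpa using hle
  obtain ⟨hd, hs⟩ | ⟨hd, hs⟩ := neg_one_pow_cases (dd k a 0) <;> have e := modes_pos_zero ha hs
  · refine isSpanned_of_eq (c := 1) (c' := 1) (r := F k a 0 + F k 0 a)
      (i := F k (-a) 0 - F k 0 (-a)) ⟨?_, ?_⟩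
      (Or.inr (Or.inr (Or.inl ⟨a, ha, hle', hp, hn, hd, Or.inl rfl⟩)))
      (Or.inr (Or.inr (Or.inl ⟨a, ha, hle', hp, hn, hd, Or.inr rfl⟩)))
    · rw [e.1]; module
    · rw [e.2]; module
  · refine isSpanned_of_eq (c := 1) (c' := 1) (r := F k a 0 - F k 0 a)
      (i := F k (-a) 0 + F k 0 (-a)) ⟨?_, ?_⟩
      (Or.inr (Or.inr (Or.inr (Or.inl ⟨a, ha, hle', hp, hn, hd, Or.inl rfl⟩))))
      (Or.inr (Or.inr (Or.inr (Or.inl ⟨a, ha, hle', hp, hn, hd, Or.inr rfl⟩))))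
    · rw [e.1]; module
    · rw [e.2]; module

theorem isSpanned_pos_self {n : ℤ} {k : ℕ} {a : ℤ} (ha : 0 < a)
    (hw : IsInvariantWeight n k a a) : IsSpanned n k a a := by
  obtain ⟨hle, hp, hn⟩ := hw
  have hn' : Int.ModEq (2 * n) (2 * a) 0 := by rwa [two_mul a]
  by_cases hk : k % 4 = 0
  · have e := modes_pos_pos ha ha ((neg_one_pow_dd_self hle hp).trans (if_pos hk))
    refine isSpanned_of_eq (c := 2) (c' := 0) (r := F k a a - F k (-a) (-a)) (i := 0) ⟨?_, ?_⟩
      (Or.inr ?_) (Or.inl rfl)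
    · rw [e.1]; module
    · rw [e.2]; module
    · exact Or.inr (Or.inr (Or.inr (Or.inr (Or.inl ⟨a, ha, hle, hp, hn', hk, rfl⟩))))
  · have e := modes_pos_pos ha ha ((neg_one_pow_dd_self hle hp).trans (if_neg hk))
    have hk2 : k % 4 = 2 := by unfold Int.ModEq at hp; omega
    refine isSpanned_of_eq (c := 0) (c' := 2) (r := 0) (i := F k (-a) a + F k a (-a)) ⟨?_, ?_⟩
      (Or.inl rfl) (Or.inr ?_)
    · rw [e.1]; module
    · rw [e.2]; module
    · exact Or.inr (Or.inr (Or.inr (Or.inr (Or.inr (Or.inl ⟨a, ha, hle, hp, hn', hk2, rfl⟩)))))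

theorem isSpanned_pos_neg_self {n : ℤ} {k : ℕ} {a : ℤ} (ha : 0 < a)
    (hw : IsInvariantWeight n k a (-a)) : IsSpanned n k a (-a) := by
  obtain ⟨hle, hp, -⟩ := hw
  rw [Int.natAbs_neg] at hle
  have hp' : Int.ModEq 2 (a + a) k := by unfold Int.ModEq at *; omega
  by_cases hk : k % 4 = 0
  · have e := modes_pos_neg ha ha ((neg_one_pow_dd_self hle hp').trans (if_pos hk))
    refine isSpanned_of_eq (c := 2) (c' := 2) (r := F k a a + F k (-a) (-a))
      (i := F k (-a) a - F k a (-a)) ⟨?_, ?_⟩ (Or.inr ?_) (Or.inr ?_)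
    · rw [e.1]; module
    · rw [e.2]; module
    · exact Or.inr (Or.inr (Or.inr (Or.inl ⟨a, ha, hle, hp', hk, Or.inl rfl⟩)))
    · exact Or.inr (Or.inr (Or.inr (Or.inl ⟨a, ha, hle, hp', hk, Or.inr rfl⟩)))
  · have e := modes_pos_neg ha ha ((neg_one_pow_dd_self hle hp').trans (if_neg hk))
    refine isSpanned_of_eq (c := 0) (c' := 0) (r := 0) (i := 0) ⟨?_, ?_⟩ (Or.inl rfl) (Or.inl rfl)
    · rw [e.1]; module
    · rw [e.2]; module

theorem isSpanned_pos_pos {n : ℤ} {k : ℕ} {a b : ℤ} (ha : 0 < a) (hb : 0 < b) (hab : a ≠ b)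
    (hw : IsInvariantWeight n k a b) : IsSpanned n k a b := by
  obtain ⟨hle, hp, hn⟩ := hw
  have hn' : Int.ModEq (2 * n) a (-b) := Int.modEq_iff_sub_modEq_zero.2 (by rwa [_root_.neg_neg])
  obtain ⟨-, hs⟩ | ⟨-, hs⟩ := neg_one_pow_cases (dd k a b + b.natAbs) <;>
    have e := modes_pos_pos ha hb hs <;> rw [← sgn_of_pos k ha hb] at hs
  · refine isSpanned_of_eq (c := 1) (c' := 1)
      (r := (F k a b - F k (-a) (-b)) + (F k b a - F k (-b) (-a)))
      (i := (F k a (-b) + F k (-a) b) - (F k (-b) a + F k b (-a))) ⟨?_, ?_⟩ (Or.inr ?_) (Or.inr ?_)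
    · rw [e.1]; module
    · rw [e.2]; module
    · exact Or.inr (Or.inr (Or.inr (Or.inr (Or.inr (Or.inr (Or.inr (Or.inr (Or.inl
        ⟨a, b, ha, hb, hab, hle, hp, hn', hs, Or.inl rfl⟩))))))))
    · exact Or.inr (Or.inr (Or.inr (Or.inr (Or.inr (Or.inr (Or.inr (Or.inr (Or.inl
        ⟨a, b, ha, hb, hab, hle, hp, hn', hs, Or.inr rfl⟩))))))))
  · refine isSpanned_of_eq (c := 1) (c' := 1)
      (r := (F k a b - F k (-a) (-b)) - (F k b a - F k (-b) (-a)))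
      (i := (F k a (-b) + F k (-a) b) + (F k (-b) a + F k b (-a))) ⟨?_, ?_⟩ (Or.inr ?_) (Or.inr ?_)
    · rw [e.1]; module
    · rw [e.2]; module
    · exact Or.inr (Or.inr (Or.inr (Or.inr (Or.inr (Or.inr (Or.inr (Or.inr (Or.inr
        ⟨a, b, ha, hb, hab, hle, hp, hn', hs, Or.inl rfl⟩))))))))
    · exact Or.inr (Or.inr (Or.inr (Or.inr (Or.inr (Or.inr (Or.inr (Or.inr (Or.inr
        ⟨a, b, ha, hb, hab, hle, hp, hn', hs, Or.inr rfl⟩))))))))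

theorem isSpanned_pos_neg {n : ℤ} {k : ℕ} {a b : ℤ} (ha : 0 < a) (hb : 0 < b) (hab : a ≠ b)
    (hw : IsInvariantWeight n k a (-b)) : IsSpanned n k a (-b) := by
  obtain ⟨hle, hp, hn⟩ := hw
  rw [Int.natAbs_neg] at hle
  have hp' : Int.ModEq 2 (a + b) k := by unfold Int.ModEq at *; omega
  have hn' : Int.ModEq (2 * n) a b := Int.modEq_iff_sub_modEq_zero.2 hn
  obtain ⟨-, hs⟩ | ⟨-, hs⟩ := neg_one_pow_cases (dd k a b + b.natAbs) <;>
    have e := modes_pos_neg ha hb hs <;> rw [← sgn_of_pos k ha hb] at hs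
  · refine isSpanned_of_eq (c := 1) (c' := -1)
      (r := (F k a b + F k (-a) (-b)) + (F k b a + F k (-b) (-a)))
      (i := (F k a (-b) - F k (-a) b) - (F k (-b) a - F k b (-a))) ⟨?_, ?_⟩ (Or.inr ?_) (Or.inr ?_)
    · rw [e.1]; module
    · rw [e.2]; module
    · exact Or.inr (Or.inr (Or.inr (Or.inr (Or.inr (Or.inr (Or.inl
        ⟨a, b, ha, hb, hab, hle, hp', hn', hs, Or.inl rfl⟩))))))
    · exact Or.inr (Or.inr (Or.inr (Or.inr (Or.inr (Or.inr (Or.inl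
        ⟨a, b, ha, hb, hab, hle, hp', hn', hs, Or.inr rfl⟩))))))
  · refine isSpanned_of_eq (c := 1) (c' := -1)
      (r := (F k a b + F k (-a) (-b)) - (F k b a + F k (-b) (-a)))
      (i := (F k a (-b) - F k (-a) b) + (F k (-b) a - F k b (-a))) ⟨?_, ?_⟩ (Or.inr ?_) (Or.inr ?_)
    · rw [e.1]; module
    · rw [e.2]; module
    · exact Or.inr (Or.inr (Or.inr (Or.inr (Or.inr (Or.inr (Or.inr (Or.inl
        ⟨a, b, ha, hb, hab, hle, hp', hn', hs, Or.inl rfl⟩)))))))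
    · exact Or.inr (Or.inr (Or.inr (Or.inr (Or.inr (Or.inr (Or.inr (Or.inl
        ⟨a, b, ha, hb, hab, hle, hp', hn', hs, Or.inr rfl⟩)))))))

theorem IsInvariantWeight.even {n : ℤ} {k : ℕ} {L M : ℤ} (h : IsInvariantWeight n k L M) :
    Even (L + M) :=
  even_iff_two_dvd.2 ((dvd_mul_right 2 n).trans (Int.modEq_zero_iff_dvd.1 h.2.2))

theorem IsInvariantWeight.neg_neg {n : ℤ} {k : ℕ} {L M : ℤ} (h : IsInvariantWeight n k L M) :
    IsInvariantWeight n k (-L) (-M) := by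
  obtain ⟨hle, hp, hn⟩ := h
  refine ⟨by simpa using hle, by unfold Int.ModEq at *; omega, ?_⟩
  rw [Int.modEq_zero_iff_dvd] at hn ⊢
  rwa [← neg_add, dvd_neg]

theorem IsInvariantWeight.neg_swap {n : ℤ} {k : ℕ} {L M : ℤ} (h : IsInvariantWeight n k L M) :
    IsInvariantWeight n k (-M) (-L) := by
  obtain ⟨hle, hp, hn⟩ := h.neg_neg
  exact ⟨by rwa [add_comm], by rwa [add_comm], by rwa [add_comm]⟩

theorem isSpanned_of_pos {n : ℤ} {k : ℕ} {L M : ℤ} (hL : 0 < L)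
    (hw : IsInvariantWeight n k L M) : IsSpanned n k L M := by
  rcases lt_trichotomy M 0 with hM | rfl | hM
  · obtain ⟨b, rfl⟩ : ∃ b, M = -b := ⟨-M, by simp⟩
    obtain rfl | hne := eq_or_ne L b
    · exact isSpanned_pos_neg_self hL hw
    · exact isSpanned_pos_neg hL (by omega) hne hw
  · exact isSpanned_pos_zero hL hw
  · obtain rfl | hne := eq_or_ne L M
    · exact isSpanned_pos_self hL hw
    · exact isSpanned_pos_pos hL hM hne hw

theorem IsInvariantWeight.isSpanned {n : ℤ} {k : ℕ} {L M : ℤ} (hw : IsInvariantWeight n k L M) :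
    IsSpanned n k L M := by
  rcases lt_trichotomy L 0 with hL | rfl | hL
  · exact (isSpanned_of_pos (by omega) hw.neg_neg).neg_neg
  · have hsw : IsSpanned n k (-M) (-0) → IsSpanned n k 0 M := fun h => by
      simpa using h.neg_swap (by simpa using hw.even)
    rcases lt_trichotomy M 0 with hM | rfl | hM
    · exact hsw (isSpanned_of_pos (by omega) hw.neg_swap)
    · exact isSpanned_zero_zero hw
    · refine hsw (IsSpanned.neg_neg (isSpanned_of_pos (by omega) hw.neg_swap.neg_neg))
  · exact isSpanned_of_pos hL hw

theorem span_symModes_eq (n : ℤ) (k : ℕ) :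
    Submodule.span ℝ (symModes n k) = Submodule.span ℝ (invariantModes n k) := by
  refine le_antisymm (Submodule.span_le.2 ?_) (Submodule.span_le.2 (invariantModes_subset n k))
  rintro h ⟨L, M, hw, rfl | rfl⟩
  · exact hw.isSpanned.1
  · exact hw.isSpanned.2

theorem comp_eq_of_mem_span_symModes {n : ℤ} (hn : 1 ≤ n) {k : ℕ} {f : (Fin 4 → ℝ) → ℝ}
    (hf : f ∈ Submodule.span ℝ (symModes n k)) :
    f ∘ Rrot (Real.pi / n) (Real.pi / n) = f ∧ f ∘ Amap = f := by
  induction hf using Submodule.span_induction with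
  | mem f hf =>
    obtain ⟨L, M, hw, rfl | rfl⟩ := hf <;> constructor <;> funext p
    · simp only [Function.comp_apply, reMode, symMode_Rrot hn hw.2.2]
    · simp only [Function.comp_apply, reMode, symMode_Amap hw.even]
    · simp only [Function.comp_apply, imMode, symMode_Rrot hn hw.2.2]
    · simp only [Function.comp_apply, imMode, symMode_Amap hw.even]
  | zero => exact ⟨rfl, rfl⟩
  | add f g _ _ hf hg => exact ⟨congrArg₂ (· + ·) hf.1 hg.1, congrArg₂ (· + ·) hf.2 hg.2⟩
  | smul c f _ hf => exact ⟨congrArg (c • ·) hf.1, congrArg (c • ·) hf.2⟩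

/-- Averaging over the powers of the rotation `R(π/n, π/n)` discards the modes it moves. -/
theorem eq_sum_filter_of_comp_Rrot_eq {n : ℤ} (hn : 1 ≤ n) {k : ℕ} {f : (Fin 4 → ℝ) → ℝ}
    {I : Finset (ℤ × ℤ)} {κ : ℤ × ℤ → ℂ}
    (hI : ∀ p, (f p : ℂ) = ∑ q ∈ I, κ q * complexMode k q.1 q.2 p)
    (hR : f ∘ Rrot (Real.pi / n) (Real.pi / n) = f) (p : Fin 4 → ℝ) :
    (f p : ℂ) = ∑ q ∈ I with Int.ModEq (2 * n) (q.1 + q.2) 0,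
      κ q * complexMode k q.1 q.2 p := by
  set ζ : ℂ := Complex.exp ((Real.pi / n : ℝ) * Complex.I) with hζ
  have key (j : ℕ) (p : Fin 4 → ℝ) :
      (f p : ℂ) = ∑ q ∈ I, (ζ ^ (q.1 + q.2)) ^ j * (κ q * complexMode k q.1 q.2 p) := by
    induction j generalizing p with
    | zero => simpa using hI p
    | succ j ih =>
      rw [← congrFun hR p, Function.comp_apply, ih]
      refine Finset.sum_congr rfl fun q _ => ?_
      rw [complexMode_Rrot, ← hζ, pow_succ]
      ring
  set N : ℕ := (2 * n).toNat with hN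
  have hN0 : (N : ℂ) ≠ 0 := by
    rw [Nat.cast_ne_zero]
    omega
  have geom (q : ℤ × ℤ) : ∑ j ∈ Finset.range N, (ζ ^ (q.1 + q.2)) ^ j =
      if Int.ModEq (2 * n) (q.1 + q.2) 0 then (N : ℂ) else 0 := by
    have h1 := exp_pi_div_zpow_eq_one_iff hn (q.1 + q.2)
    rw [← hζ] at h1
    split_ifs with h
    · simp [h1.2 h]
    · have hpow : (ζ ^ (q.1 + q.2)) ^ N = 1 := by
        rw [← zpow_natCast, ← zpow_mul, exp_pi_div_zpow_eq_one_iff hn, Int.modEq_zero_iff_dvd]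
        exact Dvd.intro_left (q.1 + q.2) (by rw [hN, Int.toNat_of_nonneg (by omega)])
      rw [geom_sum_eq (fun h' => h (h1.1 h')), hpow, sub_self, zero_div]
  apply mul_left_cancel₀ hN0
  calc (N : ℂ) * f p = ∑ j ∈ Finset.range N, (f p : ℂ) := by simp
    _ = ∑ j ∈ Finset.range N, ∑ q ∈ I, (ζ ^ (q.1 + q.2)) ^ j * (κ q * complexMode k q.1 q.2 p) :=
      Finset.sum_congr rfl fun j _ => key j p
    _ = ∑ q ∈ I, (∑ j ∈ Finset.range N, (ζ ^ (q.1 + q.2)) ^ j) *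
        (κ q * complexMode k q.1 q.2 p) := by
      rw [Finset.sum_comm]
      simp only [Finset.sum_mul]
    _ = _ := by
      rw [Finset.mul_sum, Finset.sum_filter]
      refine Finset.sum_congr rfl fun q _ => ?_
      rw [geom]
      split_ifs <;> simp

theorem mem_span_symModes_of_comp_eq {n : ℤ} (hn : 1 ≤ n) {k : ℕ} {f : (Fin 4 → ℝ) → ℝ}
    (hf : IsHomogeneousPolyEval k f) (hh : IsHarmonic f)
    (hR : f ∘ Rrot (Real.pi / n) (Real.pi / n) = f) (hA : f ∘ Amap = f) :
    f ∈ Submodule.span ℝ (symModes n k) := by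
  obtain ⟨I, κ, hκ, hI⟩ := exists_expansion hf hh
  have hsum := eq_sum_filter_of_comp_Rrot_eq hn hI hR
  have h2 (p : Fin 4 → ℝ) : (2 * f p : ℂ) =
      ∑ q ∈ I with Int.ModEq (2 * n) (q.1 + q.2) 0, κ q * symMode k q.1 q.2 p := by
    have hAp : (f (Amap p) : ℂ) = f p := congrArg _ (congrFun hA p)
    rw [two_mul]
    nth_rewrite 2 [← hAp]
    rw [hsum p, hsum (Amap p), ← Finset.sum_add_distrib]
    refine Finset.sum_congr rfl fun q _ => ?_
    rw [complexMode_Amap, symMode]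
    ring
  have hfeq : f = ∑ q ∈ I with Int.ModEq (2 * n) (q.1 + q.2) 0,
      (((κ q).re / 2) • reMode k q.1 q.2 - ((κ q).im / 2) • imMode k q.1 q.2) := by
    funext p
    have h := congrArg Complex.re (h2 p)
    rw [Complex.re_sum, ← Complex.ofReal_ofNat, ← Complex.ofReal_mul, Complex.ofReal_re] at h
    rw [← mul_right_inj' (two_ne_zero (α := ℝ)), h, Finset.sum_apply, Finset.mul_sum]
    refine Finset.sum_congr rfl fun q _ => ?_
    simp only [Complex.mul_re, reMode, imMode, Pi.sub_apply, Pi.smul_apply, smul_eq_mul]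
    ring
  rw [hfeq]
  refine Submodule.sum_mem _ fun q hq => ?_
  by_cases h0 : κ q = 0
  · simp [h0]
  · have hw : IsInvariantWeight n k q.1 q.2 :=
      ⟨(hκ q h0).1, (hκ q h0).2, (Finset.mem_filter.1 hq).2⟩
    exact Submodule.sub_mem _ (Submodule.smul_mem _ _ hw.reMode_mem)
      (Submodule.smul_mem _ _ hw.imMode_mem)

/-- Theorem 3: a homogeneous harmonic polynomial function of
degree `k` is invariant under both generators `R(π/n, π/n)` and `A` of the
binary dihedral group `D*_n` iff it is a real linear combination of the listed
eigenmodes. -/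
theorem stmt_15 (n : ℤ) (hn : 1 ≤ n) (k : ℕ) (f : (Fin 4 → ℝ) → ℝ)
    (hf : IsHomogeneousPolyEval k f) (hh : IsHarmonic f) :
    (f ∘ Rrot (Real.pi / n) (Real.pi / n) = f ∧ f ∘ Amap = f) ↔
    f ∈ Submodule.span ℝ {h : (Fin 4 → ℝ) → ℝ |
      -- Ψ_{k,0,0} when k ≡ 0 (mod 4)
      (Int.ModEq 2 0 k ∧ k % 4 = 0 ∧ h = F k 0 0) ∨
      -- Ψ_{k,ℓ,0} + Ψ_{k,0,ℓ} and Ψ_{k,-ℓ,0} - Ψ_{k,0,-ℓ},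
      -- when ℓ ≡ 0 (mod 2n) and d even
      (∃ ℓ : ℤ, 0 < ℓ ∧ ℓ.natAbs ≤ k ∧ Int.ModEq 2 ℓ k ∧
        Int.ModEq (2 * n) ℓ 0 ∧ Even (dd k ℓ 0) ∧
        (h = F k ℓ 0 + F k 0 ℓ ∨ h = F k (-ℓ) 0 - F k 0 (-ℓ))) ∨
      -- Ψ_{k,ℓ,0} - Ψ_{k,0,ℓ} and Ψ_{k,-ℓ,0} + Ψ_{k,0,-ℓ},
      -- when ℓ ≡ 0 (mod 2n) and d odd
      (∃ ℓ : ℤ, 0 < ℓ ∧ ℓ.natAbs ≤ k ∧ Int.ModEq 2 ℓ k ∧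
        Int.ModEq (2 * n) ℓ 0 ∧ ¬ Even (dd k ℓ 0) ∧
        (h = F k ℓ 0 - F k 0 ℓ ∨ h = F k (-ℓ) 0 + F k 0 (-ℓ))) ∨
      -- Ψ_{k,ℓ,ℓ} + Ψ_{k,-ℓ,-ℓ} and Ψ_{k,-ℓ,ℓ} - Ψ_{k,ℓ,-ℓ}, when k ≡ 0 (mod 4)
      (∃ ℓ : ℤ, 0 < ℓ ∧ ℓ.natAbs + ℓ.natAbs ≤ k ∧ Int.ModEq 2 (ℓ + ℓ) k ∧
        k % 4 = 0 ∧
        (h = F k ℓ ℓ + F k (-ℓ) (-ℓ) ∨ h = F k (-ℓ) ℓ - F k ℓ (-ℓ))) ∨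
      -- Ψ_{k,ℓ,ℓ} - Ψ_{k,-ℓ,-ℓ}, when 2ℓ ≡ 0 (mod 2n) and k ≡ 0 (mod 4)
      (∃ ℓ : ℤ, 0 < ℓ ∧ ℓ.natAbs + ℓ.natAbs ≤ k ∧ Int.ModEq 2 (ℓ + ℓ) k ∧
        Int.ModEq (2 * n) (2 * ℓ) 0 ∧ k % 4 = 0 ∧
        h = F k ℓ ℓ - F k (-ℓ) (-ℓ)) ∨
      -- Ψ_{k,-ℓ,ℓ} + Ψ_{k,ℓ,-ℓ}, when 2ℓ ≡ 0 (mod 2n) and k ≡ 2 (mod 4)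
      (∃ ℓ : ℤ, 0 < ℓ ∧ ℓ.natAbs + ℓ.natAbs ≤ k ∧ Int.ModEq 2 (ℓ + ℓ) k ∧
        Int.ModEq (2 * n) (2 * ℓ) 0 ∧ k % 4 = 2 ∧
        h = F k (-ℓ) ℓ + F k ℓ (-ℓ)) ∨
      -- distinct ℓ ≠ m, ℓ ≡ m (mod 2n), σ_{kℓm} = +1
      (∃ ℓ m : ℤ, 0 < ℓ ∧ 0 < m ∧ ℓ ≠ m ∧ ℓ.natAbs + m.natAbs ≤ k ∧
        Int.ModEq 2 (ℓ + m) k ∧ Int.ModEq (2 * n) ℓ m ∧ sgn k ℓ m = 1 ∧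
        (h = (F k ℓ m + F k (-ℓ) (-m)) + (F k m ℓ + F k (-m) (-ℓ)) ∨
         h = (F k ℓ (-m) - F k (-ℓ) m) - (F k (-m) ℓ - F k m (-ℓ)))) ∨
      -- distinct ℓ ≠ m, ℓ ≡ m (mod 2n), σ_{kℓm} = -1
      (∃ ℓ m : ℤ, 0 < ℓ ∧ 0 < m ∧ ℓ ≠ m ∧ ℓ.natAbs + m.natAbs ≤ k ∧
        Int.ModEq 2 (ℓ + m) k ∧ Int.ModEq (2 * n) ℓ m ∧ sgn k ℓ m = -1 ∧
        (h = (F k ℓ m + F k (-ℓ) (-m)) - (F k m ℓ + F k (-m) (-ℓ)) ∨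
         h = (F k ℓ (-m) - F k (-ℓ) m) + (F k (-m) ℓ - F k m (-ℓ)))) ∨
      -- distinct ℓ ≠ m, ℓ ≡ -m (mod 2n), σ_{kℓm} = +1
      (∃ ℓ m : ℤ, 0 < ℓ ∧ 0 < m ∧ ℓ ≠ m ∧ ℓ.natAbs + m.natAbs ≤ k ∧
        Int.ModEq 2 (ℓ + m) k ∧ Int.ModEq (2 * n) ℓ (-m) ∧ sgn k ℓ m = 1 ∧
        (h = (F k ℓ m - F k (-ℓ) (-m)) + (F k m ℓ - F k (-m) (-ℓ)) ∨
         h = (F k ℓ (-m) + F k (-ℓ) m) - (F k (-m) ℓ + F k m (-ℓ)))) ∨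
      -- distinct ℓ ≠ m, ℓ ≡ -m (mod 2n), σ_{kℓm} = -1
      (∃ ℓ m : ℤ, 0 < ℓ ∧ 0 < m ∧ ℓ ≠ m ∧ ℓ.natAbs + m.natAbs ≤ k ∧
        Int.ModEq 2 (ℓ + m) k ∧ Int.ModEq (2 * n) ℓ (-m) ∧ sgn k ℓ m = -1 ∧
        (h = (F k ℓ m - F k (-ℓ) (-m)) - (F k m ℓ - F k (-m) (-ℓ)) ∨
         h = (F k ℓ (-m) + F k (-ℓ) m) + (F k (-m) ℓ + F k m (-ℓ))))} := by
  change _ ↔ f ∈ Submodule.span ℝ (invariantModes n k)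
  rw [← span_symModes_eq]
  exact ⟨fun h => mem_span_symModes_of_comp_eq hn hf hh h.1 h.2, comp_eq_of_mem_span_symModes hn⟩

end
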